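/- Let X: ℝ → M_n(ℝ) be continuous. Then there exists a unique continuously differentiable map hol_X: ℝ → M_n(ℝ) with ∂_s hol_X(s) = X(s)·hol_X(s) for all s and hol_X(0) = 1; moreover hol_X(s) is invertible for every s ∈ ℝ, its inverse being the unique solution k of ∂_s k(s) = −k(s)·X(s), k(0) = 1. If X is smooth then hol_X is smooth. -/

import Mathlib

/-- Global solutions of linear ODEs in a Banach space, by summing the Picard series. -/
theorem exists_global_linear_ode {E : Type*} [NormedAddCommGroup E] [NormedSpace ℝ E]
    [CompleteSpace E] (A : ℝ → E →L[ℝ] E) (hA : Continuous A) (x₀ : E) :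
    ∃ y : ℝ → E, (∀ s, HasDerivAt y (A s (y s)) s) ∧ y 0 = x₀ := by
  let u : ℕ → ℝ → E := fun k => Nat.rec (fun _ => x₀) (fun _ v t => ∫ s in (0:ℝ)..t, A s (v s)) k
  have u0 : ∀ t, u 0 t = x₀ := fun t => rfl
  have us : ∀ k t, u (k+1) t = ∫ s in (0:ℝ)..t, A s (u k s) := fun k t => rfl
  have key : ∀ k, Continuous (u k) → ∀ t, HasDerivAt (u (k+1)) (A t (u k t)) t := by
    intro k hk t
    have hc : Continuous fun s => A s (u k s) := hA.clm_apply hk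
    exact intervalIntegral.integral_hasDerivAt_right (hc.intervalIntegrable _ _)
      (hc.stronglyMeasurableAtFilter _ _) hc.continuousAt
  have uc : ∀ k, Continuous (u k) := by
    intro k
    induction k with
    | zero => exact continuous_const
    | succ k ih => exact continuous_iff_continuousAt.2 fun t => (key k ih t).continuousAt
  have bd : ∀ (T M : ℝ), (∀ s, |s| ≤ T → ‖A s‖ ≤ M) → 0 ≤ M → ∀ k t, |t| ≤ T →
      ‖u k t‖ ≤ ‖x₀‖ * (M * |t|) ^ k / (k.factorial : ℝ) := by
    intro T M hM hM0 k
    induction k with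
    | zero => intro t _; simp [u0]
    | succ k ih =>
      intro t ht
      rw [us, intervalIntegral.norm_integral_eq_norm_integral_uIoc]
      have h1 : ‖∫ s in Set.uIoc 0 t, A s (u k s)‖ ≤
          ∫ s in Set.uIoc 0 t, (‖x₀‖ * M ^ (k+1) / (k.factorial : ℝ)) * |s - 0| ^ k := by
        apply MeasureTheory.norm_integral_le_of_norm_le
        · have : Continuous fun s : ℝ =>
              (‖x₀‖ * M ^ (k+1) / (k.factorial : ℝ)) * |s - 0| ^ k := by fun_prop
          exact (this.integrableOn_uIcc (a := 0) (b := t)).mono_set Set.uIoc_subset_uIcc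
        · refine (MeasureTheory.ae_restrict_iff' measurableSet_uIoc).2 (Filter.Eventually.of_forall ?_)
          intro s hs
          have hs' : |s| ≤ |t| := by
            have := Set.abs_sub_left_of_mem_uIcc (Set.uIoc_subset_uIcc hs)
            simpa using this
          have hsT := hs'.trans ht
          calc ‖A s (u k s)‖ ≤ ‖A s‖ * ‖u k s‖ := (A s).le_opNorm _
            _ ≤ M * (‖x₀‖ * (M * |s|) ^ k / (k.factorial : ℝ)) :=
              mul_le_mul (hM s hsT) (ih s hsT) (norm_nonneg _) hM0
            _ = _ := by rw [sub_zero, mul_pow]; ring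
      refine h1.trans (le_of_eq ?_)
      rw [MeasureTheory.integral_const_mul, integral_pow_abs_sub_uIoc, Nat.factorial_succ, sub_zero,
        mul_pow]
      push_cast
      field_simp
  have main : ∀ T : ℝ, 0 < T → (∀ s ∈ Metric.ball (0:ℝ) T, Summable fun k => u k s) ∧
      ∀ s ∈ Metric.ball (0:ℝ) T,
        HasDerivAt (fun t => ∑' k, u (k+1) t) (∑' k, A s (u k s)) s := by
    intro T hT
    obtain ⟨M, hM⟩ := (isCompact_closedBall (0:ℝ) T).exists_bound_of_continuousOn hA.continuousOn
    have hM' : ∀ s, |s| ≤ T → ‖A s‖ ≤ M := fun s hs => hM s (by simpa using hs)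
    have hM0 : 0 ≤ M := (norm_nonneg _).trans (hM' 0 (by simpa using hT.le))
    have hsum : Summable fun k : ℕ => ‖x₀‖ * ((M * T) ^ k / (k.factorial : ℝ)) :=
      (Real.summable_pow_div_factorial (M * T)).mul_left _
    have hb : ∀ k s, s ∈ Metric.ball (0:ℝ) T →
        ‖u k s‖ ≤ ‖x₀‖ * ((M * T) ^ k / (k.factorial : ℝ)) := by
      intro k s hs
      have hs' : |s| ≤ T := by simpa using (Metric.ball_subset_closedBall hs)
      refine (bd T M hM' hM0 k s hs').trans ?_
      rw [mul_div_assoc]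
      gcongr
    have hS : ∀ s ∈ Metric.ball (0:ℝ) T, Summable fun k => u k s := fun s hs =>
      Summable.of_norm_bounded hsum fun k => hb k s hs
    refine ⟨hS, fun s hs => ?_⟩
    refine hasDerivAt_tsum_of_isPreconnected (hsum.mul_left M) Metric.isOpen_ball
      (convex_ball (0:ℝ) T).isPreconnected (fun k t _ => key k (uc k) t) ?_ hs
      ((summable_nat_add_iff 1).2 (hS s hs)) hs
    intro k t ht
    have ht' : |t| ≤ T := by simpa using (Metric.ball_subset_closedBall ht)
    exact ((A t).le_opNorm _).trans (mul_le_mul (hM' t ht') (hb k t ht) (norm_nonneg _) hM0)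
  have hS : ∀ s, Summable fun k => u k s := fun s =>
    (main (|s| + 1) (by positivity)).1 s (by simp)
  refine ⟨fun t => ∑' k, u k t, fun s => ?_, ?_⟩
  · have h := (main (|s| + 1) (by positivity)).2 s (by simp)
    have e : (fun t => ∑' k, u k t) = fun t => x₀ + ∑' k, u (k+1) t := by
      funext t
      rw [(hS t).tsum_eq_zero_add, u0]
    have e2 : A s (∑' k, u k s) = ∑' k, A s (u k s) := (A s).map_tsum (hS s)
    show HasDerivAt (fun t => ∑' k, u k t) (A s (∑' k, u k s)) s
    rw [e2, e]
    exact h.const_add x₀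
  · show ∑' k, u k 0 = x₀
    rw [(hS 0).tsum_eq_zero_add]
    simp [us, u0]


/-- The statement in a general Banach algebra in which one-sided inverses are two-sided. -/
theorem holonomy_general {R : Type*} [NormedRing R] [NormedAlgebra ℝ R] [CompleteSpace R]
    (comm : ∀ a b : R, a * b = 1 → b * a = 1) (X : ℝ → R) (hX : Continuous X) :
    ∃ hol : ℝ → R,
      -- existence of a C¹ solution
      (ContDiff ℝ 1 hol ∧ (∀ s, HasDerivAt hol (X s * hol s) s) ∧ hol 0 = 1) ∧
      -- uniqueness
      (∀ h₂ : ℝ → R, ContDiff ℝ 1 h₂ →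
        (∀ s, HasDerivAt h₂ (X s * h₂ s) s) → h₂ 0 = 1 → h₂ = hol) ∧
      -- pointwise invertibility, the inverse being the unique solution of `k' = -k·X, k 0 = 1`
      (∃ k : ℝ → R,
        (ContDiff ℝ 1 k ∧ (∀ s, HasDerivAt k (-(k s * X s)) s) ∧ k 0 = 1) ∧
        (∀ k₂ : ℝ → R, ContDiff ℝ 1 k₂ →
          (∀ s, HasDerivAt k₂ (-(k₂ s * X s)) s) → k₂ 0 = 1 → k₂ = k) ∧
        (∀ s, k s * hol s = 1 ∧ hol s * k s = 1)) ∧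
      -- smoothness
      (ContDiff ℝ (⊤ : ℕ∞) X → ContDiff ℝ (⊤ : ℕ∞) hol) := by
  have c1 : ∀ f f' : ℝ → R, (∀ s, HasDerivAt f (f' s) s) →
      Continuous f' → ContDiff ℝ 1 f := by
    intro f f' hf hf'
    rw [contDiff_one_iff_deriv]
    refine ⟨fun s => (hf s).differentiableAt, ?_⟩
    rwa [show deriv f = f' from funext fun s => (hf s).deriv]
  have cont : ∀ f f' : ℝ → R, (∀ s, HasDerivAt f (f' s) s) →
      Continuous f := fun f f' hf => continuous_iff_continuousAt.2 fun s => (hf s).continuousAt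
  obtain ⟨hol, hd, h0⟩ := exists_global_linear_ode
    (fun s => ContinuousLinearMap.mul ℝ R (X s))
    ((ContinuousLinearMap.mul ℝ R).continuous.comp hX) 1
  obtain ⟨k, kd, k0⟩ := exists_global_linear_ode
    (fun s => -((ContinuousLinearMap.mul ℝ R).flip (X s)))
    (((ContinuousLinearMap.mul ℝ R).flip.continuous.comp hX).neg) 1
  replace hd : ∀ s, HasDerivAt hol (X s * hol s) s := hd
  replace kd : ∀ s, HasDerivAt k (-(k s * X s)) s := kd
  have inv : ∀ h k : ℝ → R, (∀ s, HasDerivAt h (X s * h s) s) →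
      h 0 = 1 → (∀ s, HasDerivAt k (-(k s * X s)) s) → k 0 = 1 → ∀ s, k s * h s = 1 := by
    intro h k hd h0 kd k0 s
    have hz : ∀ t, HasDerivAt (fun t => k t * h t) 0 t := by
      intro t
      have := (kd t).mul (hd t)
      have e : -(k t * X t) * h t + k t * (X t * h t) = 0 := by
        rw [neg_mul, mul_assoc, neg_add_cancel]
      rw [e] at this
      exact this
    have := is_const_of_deriv_eq_zero (fun t => (hz t).differentiableAt)
      (fun t => (hz t).deriv) s 0
    simpa [h0, k0] using this
  have hk := inv hol k hd h0 kd k0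
  have hk' : ∀ s, hol s * k s = 1 := fun s => comm _ _ (hk s)
  refine ⟨hol, ⟨c1 _ _ hd (hX.mul (cont _ _ hd)), hd, h0⟩, ?_, ⟨k, ⟨c1 _ _ kd
    ((cont _ _ kd).mul hX).neg, kd, k0⟩, ?_, fun s => ⟨hk s, hk' s⟩⟩, ?_⟩
  · intro h₂ _ h2d h20
    funext s
    exact (left_inv_eq_right_inv (hk' s) (inv h₂ k h2d h20 kd k0 s)).symm
  · intro k₂ _ k2d k20
    funext s
    exact left_inv_eq_right_inv (inv hol k₂ hd h0 k2d k20 s) (hk' s)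
  · intro hXs
    rw [contDiff_infty] at hXs ⊢
    intro m
    induction m with
    | zero => exact contDiff_zero.2 (cont _ _ hd)
    | succ m ih =>
      rw [Nat.cast_succ, contDiff_succ_iff_deriv]
      refine ⟨fun s => (hd s).differentiableAt, by simp, ?_⟩
      rw [show deriv hol = fun s => X s * hol s from funext fun s => (hd s).deriv]
      exact (hXs m).mul ih

attribute [local instance] Matrix.linftyOpNormedAddCommGroup Matrix.linftyOpNormedRing
  Matrix.linftyOpNormedAlgebra

/-- For continuous `X : ℝ → M_n(ℝ)` there is a unique continuously
differentiable `hol_X : ℝ → M_n(ℝ)` with `∂ₛ hol_X = X·hol_X` and `hol_X 0 = 1`;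
moreover `hol_X s` is invertible for every `s`, its inverse being the unique solution `k`
of `∂ₛ k = −k·X`, `k 0 = 1`; and if `X` is smooth then `hol_X` is smooth. -/
theorem holonomy_exists_unique_invertible
    (n : ℕ) (X : ℝ → Matrix (Fin n) (Fin n) ℝ) (hX : Continuous X) :
    ∃ hol : ℝ → Matrix (Fin n) (Fin n) ℝ,
      -- existence of a C¹ solution
      (ContDiff ℝ 1 hol ∧ (∀ s, HasDerivAt hol (X s * hol s) s) ∧ hol 0 = 1) ∧
      -- uniqueness
      (∀ h₂ : ℝ → Matrix (Fin n) (Fin n) ℝ, ContDiff ℝ 1 h₂ →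
        (∀ s, HasDerivAt h₂ (X s * h₂ s) s) → h₂ 0 = 1 → h₂ = hol) ∧
      -- pointwise invertibility, the inverse being the unique solution of `k' = -k·X, k 0 = 1`
      (∃ k : ℝ → Matrix (Fin n) (Fin n) ℝ,
        (ContDiff ℝ 1 k ∧ (∀ s, HasDerivAt k (-(k s * X s)) s) ∧ k 0 = 1) ∧
        (∀ k₂ : ℝ → Matrix (Fin n) (Fin n) ℝ, ContDiff ℝ 1 k₂ →
          (∀ s, HasDerivAt k₂ (-(k₂ s * X s)) s) → k₂ 0 = 1 → k₂ = k) ∧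
        (∀ s, k s * hol s = 1 ∧ hol s * k s = 1)) ∧
      -- smoothness
      (ContDiff ℝ (⊤ : ℕ∞) X → ContDiff ℝ (⊤ : ℕ∞) hol) := by
  exact holonomy_general (fun a b h => mul_eq_one_comm.1 h) X hX
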